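/- For all n ≥ 1 and m ≥ 1, the map P : D(n,m) → Ω ℝP^m, sending a tuple (p_0,…,p_m) to the based loop x ↦ [p_0(x):⋯:p_m(x)] for x ∈ ℝ and ∞ ↦ *, is continuous, its image is exactly rat(n,m), and P is a homotopy equivalence from D(n,m) to rat(n,m). -/

import Mathlib

open OnePoint Projectivization

noncomputable section

/-- Real projective `m`-space, the projectivization of `ℝ^{m+1}`. -/
abbrev RP (m : ℕ) := Projectivization ℝ (Fin (m + 1) → ℝ)

instance (m : ℕ) : TopologicalSpace (RP m) :=
  inferInstanceAs (TopologicalSpace (Quotient _))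

/-- The basepoint `[1 : 1 : ⋯ : 1]` of `ℝP^m`. -/
def basept (m : ℕ) : RP m :=
  Projectivization.mk ℝ (fun _ => (1 : ℝ)) (by
    intro h
    exact one_ne_zero (congrFun h 0))

/-- The based loop space `Ω ℝP^m`: continuous maps `ℝP¹ = ℝ ∪ {∞} → ℝP^m`
sending `∞` to the basepoint, with the compact-open topology. -/
abbrev OmegaRP (m : ℕ) := {f : C(OnePoint ℝ, RP m) // f ∞ = basept m}

/-- The set of based loops arising from `(m+1)`-tuples of monic real polynomials of
degree `n` with no common complex root. -/
def RRat (n m : ℕ) : Set (OmegaRP m) :=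
  {f | ∃ p : Fin (m + 1) → Polynomial ℝ,
    (∀ i, (p i).Monic) ∧ (∀ i, (p i).natDegree = n) ∧
    (∀ z : ℂ, ∃ i, Polynomial.aeval z (p i) ≠ 0) ∧
    ∀ x : ℝ, ∃ hx : (fun i => (p i).eval x) ≠ 0,
      f.1 (x : OnePoint ℝ) = Projectivization.mk ℝ (fun i => (p i).eval x) hx}

/-- `rat n m` is the closure of `RRat n m` in `Ω ℝP^m`. -/
def ratSet (n m : ℕ) : Set (OmegaRP m) := closure (RRat n m)

/-- Evaluation at `x` of the monic polynomial `x^n + ∑_{j<n} c_j x^j` determined by the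
coefficient vector `c`. -/
def evalMonic (n : ℕ) (c : Fin n → ℝ) (x : ℝ) : ℝ :=
  x ^ n + ∑ j : Fin n, c j * x ^ (j : ℕ)

/-- `D(n,m)`: the space of `(m+1)`-tuples of monic real polynomials of degree `n`
(recorded by their lower-order coefficient vectors, i.e. as a subspace of `ℝ^{n(m+1)}`)
having no common real root. -/
def Dspace (n m : ℕ) : Set (Fin (m + 1) → Fin n → ℝ) :=
  {c | ∀ x : ℝ, ∃ i, evalMonic n (c i) x ≠ 0}

open Filter Topology Matrix

/-- The Veronese embedding, sending a line in `ℝ^{m+1}` to the matrix of the orthogonal projection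
onto it. -/
def veronese (m : ℕ) : RP m → EuclideanSpace ℝ (Fin (m + 1) × Fin (m + 1)) :=
  Projectivization.lift
    (fun v => WithLp.toLp 2 fun ij => v.1 ij.1 * v.1 ij.2 / (v.1 ⬝ᵥ v.1))
    (by
      rintro ⟨a, ha⟩ ⟨b, hb⟩ t h
      ext ij
      simp only at h
      subst h
      have ht : t ≠ 0 := by rintro rfl; simp at ha
      have hb' : b ⬝ᵥ b ≠ 0 := by simpa using hb
      simp only [smul_dotProduct, dotProduct_smul, Pi.smul_apply, smul_eq_mul]
      field_simp)

theorem veronese_mk {m : ℕ} (v : Fin (m + 1) → ℝ) (hv : v ≠ 0) (i j : Fin (m + 1)) :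
    veronese m (Projectivization.mk ℝ v hv) (i, j) = v i * v j / (v ⬝ᵥ v) := rfl

theorem continuous_mk_RP (m : ℕ) :
    Continuous fun v : {v : Fin (m + 1) → ℝ // v ≠ 0} => (Projectivization.mk ℝ v.1 v.2 : RP m) :=
  continuous_quotient_mk'

theorem continuous_veronese (m : ℕ) : Continuous (veronese m) := by
  refine Continuous.quotient_lift ?_ _
  have hc : ∀ i, Continuous fun v : {v : Fin (m + 1) → ℝ // v ≠ 0} => v.1 i := fun i =>
    (continuous_apply i).comp continuous_subtype_val
  refine (PiLp.continuous_toLp 2 _).comp (continuous_pi fun ij => ?_)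
  exact ((hc _).mul (hc _)).div (continuous_finsetSum _ fun k _ => (hc k).mul (hc k))
    fun v => by simpa using v.2

theorem eq_mk_iff_sum_veronese {m : ℕ} (x : RP m) (u : Fin (m + 1) → ℝ) (hu : u ≠ 0) :
    x = Projectivization.mk ℝ u hu ↔ ∀ i, ∑ k, veronese m x (i, k) * u k = u i := by
  constructor
  · rintro rfl i
    have hu' : u ⬝ᵥ u ≠ 0 := by simpa using hu
    simp only [veronese_mk]
    have : ∀ k, u i * u k / (u ⬝ᵥ u) * u k = u i / (u ⬝ᵥ u) * (u k * u k) := fun k => by ring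
    simp only [this, ← Finset.mul_sum]
    exact div_mul_cancel₀ _ hu'
  · induction x using Projectivization.ind with
    | h v hv =>
      intro h
      refine ((Projectivization.mk_eq_mk_iff' ℝ u v hu hv).2 ⟨(v ⬝ᵥ u) / (v ⬝ᵥ v), ?_⟩).symm
      ext i
      rw [← h i]
      simp only [veronese_mk, Pi.smul_apply, smul_eq_mul, dotProduct, Finset.sum_div,
        Finset.sum_mul]
      exact Finset.sum_congr rfl fun k _ => by ring

theorem veronese_injective (m : ℕ) : Function.Injective (veronese m) := by
  intro x y h
  induction y using Projectivization.ind with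
  | h v hv =>
    rw [eq_mk_iff_sum_veronese, h]
    exact (eq_mk_iff_sum_veronese _ v hv).1 rfl

instance compactSpace_RP (m : ℕ) : CompactSpace (RP m) := by
  have hne : ∀ v : Metric.sphere (0 : Fin (m + 1) → ℝ) 1, v.1 ≠ 0 := fun v h => by
    simpa [h] using v.2
  let f : Metric.sphere (0 : Fin (m + 1) → ℝ) 1 → RP m := fun v =>
    Projectivization.mk ℝ v.1 (hne v)
  have hf : Continuous f :=
    (continuous_mk_RP m).comp (Continuous.subtype_mk continuous_subtype_val hne)
  have hs : Function.Surjective f := by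
    intro x
    induction x using Projectivization.ind with
    | h v hv =>
      have hv' : ‖v‖ ≠ 0 := by simpa using hv
      refine ⟨⟨‖v‖⁻¹ • v, by simp [norm_smul, hv']⟩, ?_⟩
      exact (Projectivization.mk_eq_mk_iff' ℝ _ _ _ _).2 ⟨‖v‖⁻¹, rfl⟩
  exact hs.compactSpace hf

theorem isEmbedding_veronese (m : ℕ) : IsEmbedding (veronese m) :=
  ((continuous_veronese m).isClosedEmbedding (veronese_injective m)).isEmbedding

theorem dist_veronese_sq {m : ℕ} (u v : Fin (m + 1) → ℝ) (hu : u ≠ 0) (hv : v ≠ 0) :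
    dist (veronese m (Projectivization.mk ℝ u hu)) (veronese m (Projectivization.mk ℝ v hv)) ^ 2 =
      2 - 2 * ((u ⬝ᵥ v) ^ 2 / ((u ⬝ᵥ u) * (v ⬝ᵥ v))) := by
  have hu' : u ⬝ᵥ u ≠ 0 := by simpa using hu
  have hv' : v ⬝ᵥ v ≠ 0 := by simpa using hv
  have key : ∀ a b c d : Fin (m + 1) → ℝ,
      ∑ i, ∑ j, (a i * b j) * (c i * d j) = (a ⬝ᵥ c) * (b ⬝ᵥ d) := by
    intro a b c d
    simp only [dotProduct, Finset.sum_mul_sum]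
    exact Finset.sum_congr rfl fun i _ => Finset.sum_congr rfl fun j _ => by ring
  rw [EuclideanSpace.dist_sq_eq, Fintype.sum_prod_type]
  have : ∀ i j, dist (veronese m (Projectivization.mk ℝ u hu) (i, j))
      (veronese m (Projectivization.mk ℝ v hv) (i, j)) ^ 2 =
      (u i * u j) * (u i * u j) / (u ⬝ᵥ u) ^ 2 + (v i * v j) * (v i * v j) / (v ⬝ᵥ v) ^ 2
        - 2 * ((u i * u j) * (v i * v j)) / ((u ⬝ᵥ u) * (v ⬝ᵥ v)) := by
    intro i j
    rw [Real.dist_eq, sq_abs, veronese_mk, veronese_mk]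
    field_simp
    ring
  simp only [this, Finset.sum_add_distrib, Finset.sum_sub_distrib, ← Finset.sum_div,
    ← Finset.mul_sum, key]
  field_simp
  ring

/-- The embedding of the loop space in a normed space induced by the Veronese embedding. -/
def loopEmbedding (m : ℕ) (f : OmegaRP m) :
    C(OnePoint ℝ, EuclideanSpace ℝ (Fin (m + 1) × Fin (m + 1))) :=
  ContinuousMap.comp ⟨veronese m, continuous_veronese m⟩ f.1

theorem loopEmbedding_apply {m : ℕ} (f : OmegaRP m) (x : OnePoint ℝ) :
    loopEmbedding m f x = veronese m (f.1 x) := rfl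

theorem isEmbedding_loopEmbedding (m : ℕ) : IsEmbedding (loopEmbedding m) :=
  (ContinuousMap.isEmbedding_postcomp _ (isEmbedding_veronese m)).comp IsEmbedding.subtypeVal

theorem tendsto_evalMonic_div_pow {n : ℕ} (c : Fin n → ℝ) :
    Tendsto (fun p : (Fin n → ℝ) × ℝ => evalMonic n p.1 p.2 / p.2 ^ n)
      (𝓝 c ×ˢ Bornology.cobounded ℝ) (𝓝 1) := by
  have hinv : Tendsto (fun p : (Fin n → ℝ) × ℝ => p.2⁻¹) (𝓝 c ×ˢ Bornology.cobounded ℝ) (𝓝 0) :=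
    tendsto_inv₀_cobounded.comp tendsto_snd
  have hcoef : ∀ j, Tendsto (fun p : (Fin n → ℝ) × ℝ => p.1 j) (𝓝 c ×ˢ Bornology.cobounded ℝ)
      (𝓝 (c j)) := fun j => ((continuous_apply j).tendsto c).comp tendsto_fst
  have h : Tendsto (fun p : (Fin n → ℝ) × ℝ => 1 + ∑ j : Fin n, p.1 j * p.2⁻¹ ^ (n - (j : ℕ)))
      (𝓝 c ×ˢ Bornology.cobounded ℝ) (𝓝 (1 + ∑ j : Fin n, c j * 0 ^ (n - (j : ℕ)))) :=
    tendsto_const_nhds.add (tendsto_finsetSum _ fun j _ => (hcoef j).mul (hinv.pow _))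
  have hz : ∑ j : Fin n, c j * 0 ^ (n - (j : ℕ)) = 0 :=
    Finset.sum_eq_zero fun j _ => by rw [zero_pow (by have := j.2; omega), mul_zero]
  rw [hz, add_zero] at h
  refine h.congr' ?_
  have hne : ∀ᶠ p : (Fin n → ℝ) × ℝ in 𝓝 c ×ˢ Bornology.cobounded ℝ, p.2 ≠ 0 :=
    tendsto_snd.eventually (Bornology.eventually_ne_cobounded 0)
  filter_upwards [hne] with p hp
  rw [evalMonic, add_div, div_self (pow_ne_zero _ hp), Finset.sum_div]
  congr 1
  refine Finset.sum_congr rfl fun j _ => ?_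
  rw [mul_div_assoc, inv_pow, pow_sub₀ _ hp j.2.le, mul_inv, inv_inv, mul_comm (p.2 ^ n)⁻¹]
  rfl

theorem continuous_evalMonic (n : ℕ) :
    Continuous fun p : (Fin n → ℝ) × ℝ => evalMonic n p.1 p.2 := by
  unfold evalMonic
  fun_prop

theorem evalMonic_ne_zero {n m : ℕ} (c : Dspace n m) (x : ℝ) :
    (fun i => evalMonic n (c.1 i) x) ≠ 0 := by
  obtain ⟨i, hi⟩ := c.2 x
  exact fun h => hi (congrFun h i)

/-- The value at a point of `ℝ ∪ {∞}` of the loop defined by a tuple in `D(n,m)`. -/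
def evalLoop {n m : ℕ} (c : Dspace n m) : OnePoint ℝ → RP m
  | ∞ => basept m
  | (x : ℝ) => Projectivization.mk ℝ (fun i => evalMonic n (c.1 i) x) (evalMonic_ne_zero c x)

theorem continuous_evalLoop (n m : ℕ) :
    Continuous fun p : Dspace n m × OnePoint ℝ => evalLoop p.1 p.2 := by
  rw [continuous_iff_continuousAt]
  rintro ⟨c, x⟩
  induction x using OnePoint.rec with
  | coe x =>
    have hemb : IsOpenEmbedding
        (Prod.map id (↑) : Dspace n m × ℝ → Dspace n m × OnePoint ℝ) :=
      IsOpenEmbedding.id.prodMap OnePoint.isOpenEmbedding_coe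
    have : ContinuousAt ((fun p : Dspace n m × OnePoint ℝ => evalLoop p.1 p.2) ∘
        (Prod.map id (↑) : Dspace n m × ℝ → Dspace n m × OnePoint ℝ)) (c, x) := by
      refine Continuous.continuousAt ?_
      have h : Continuous fun p : Dspace n m × ℝ =>
          (⟨fun i => evalMonic n (p.1.1 i) p.2, evalMonic_ne_zero p.1 p.2⟩ :
            {v : Fin (m + 1) → ℝ // v ≠ 0}) := by
        refine Continuous.subtype_mk (continuous_pi fun i => ?_) _
        have hc : Continuous fun p : Dspace n m × ℝ => (p.1.1 i, p.2) :=
          ((continuous_apply i).comp (continuous_subtype_val.comp continuous_fst)).prodMk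
            continuous_snd
        exact (continuous_evalMonic n).comp hc
      exact (continuous_mk_RP m).comp h
    exact hemb.continuousAt_iff.1 this
  | infty =>
    rw [(isEmbedding_veronese m).isInducing.continuousAt_iff, ContinuousAt, nhds_prod_eq,
      OnePoint.nhds_infty_eq, Filter.prod_sup]
    refine Tendsto.sup ?_ ?_
    · rw [coclosedCompact_eq_cocompact, ← Metric.cobounded_eq_cocompact,
        ← Filter.map_id (f := 𝓝 c), Filter.prod_map_map_eq, tendsto_map'_iff]
      have hc : ∀ i, Tendsto (fun p : Dspace n m × ℝ => evalMonic n (p.1.1 i) p.2 / p.2 ^ n)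
          (𝓝 c ×ˢ Bornology.cobounded ℝ) (𝓝 1) := fun i =>
        (tendsto_evalMonic_div_pow (c.1 i)).comp
          ((((continuous_apply i).comp continuous_subtype_val).tendsto c).prodMap tendsto_id)
      refine ((PiLp.continuous_toLp 2 _).tendsto _).comp
        (tendsto_pi_nhds.2 fun ij => ?_)
      have hd : Tendsto (fun p : Dspace n m × ℝ =>
          ∑ k, (evalMonic n (p.1.1 k) p.2 / p.2 ^ n) * (evalMonic n (p.1.1 k) p.2 / p.2 ^ n))
          (𝓝 c ×ˢ Bornology.cobounded ℝ) (𝓝 (∑ _k : Fin (m + 1), 1 * 1)) :=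
        tendsto_finsetSum _ fun k _ => (hc k).mul (hc k)
      refine (((hc ij.1).mul (hc ij.2)).div hd ?_).congr' ?_
      · simp only [mul_one, Finset.sum_const, Finset.card_univ, Fintype.card_fin, nsmul_eq_mul]
        positivity
      · have hne : ∀ᶠ p : Dspace n m × ℝ in 𝓝 c ×ˢ Bornology.cobounded ℝ, p.2 ≠ 0 :=
          tendsto_snd.eventually (Bornology.eventually_ne_cobounded 0)
        filter_upwards [hne] with p hp
        have hp' : p.2 ^ n ≠ 0 := pow_ne_zero _ hp
        have : ∑ k, (evalMonic n (p.1.1 k) p.2 / p.2 ^ n) * (evalMonic n (p.1.1 k) p.2 / p.2 ^ n)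
            = (∑ k, evalMonic n (p.1.1 k) p.2 * evalMonic n (p.1.1 k) p.2) /
                (p.2 ^ n * p.2 ^ n) := by
          rw [Finset.sum_div]
          exact Finset.sum_congr rfl fun k _ => by rw [div_mul_div_comm]
        simp only [Pi.div_apply]
        rw [this, div_mul_div_comm, div_div_div_cancel_right₀ (mul_ne_zero hp' hp')]
        rfl
    · rw [prod_pure, tendsto_map'_iff]
      exact tendsto_const_nhds

/-- The map `P : D(n,m) → Ω ℝP^m`. -/
def toLoop (n m : ℕ) : C(Dspace n m, OmegaRP m) where
  toFun c := ⟨⟨evalLoop c,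
    (continuous_evalLoop n m).comp (by fun_prop : Continuous fun x => (c, x))⟩, rfl⟩
  continuous_toFun := Continuous.subtype_mk
    (ContinuousMap.continuous_of_continuous_uncurry _ (continuous_evalLoop n m)) _

theorem toLoop_coe {n m : ℕ} (c : Dspace n m) (x : ℝ) : (toLoop n m c).1 (x : OnePoint ℝ) =
    Projectivization.mk ℝ (fun i => evalMonic n (c.1 i) x) (evalMonic_ne_zero c x) := rfl

theorem dist_veronese_lt_iff {m : ℕ} (u v : Fin (m + 1) → ℝ) (hu : u ≠ 0) (hv : v ≠ 0) {t : ℝ}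
    (ht : 0 < t) :
    dist (veronese m (Projectivization.mk ℝ u hu)) (veronese m (Projectivization.mk ℝ v hv)) < t ↔
      (1 - t ^ 2 / 2) * (v ⬝ᵥ v) * (u ⬝ᵥ u) < (u ⬝ᵥ v) ^ 2 := by
  have hpos : ∀ v : Fin (m + 1) → ℝ, v ≠ 0 → 0 < v ⬝ᵥ v := fun v hv =>
    (show 0 ≤ v ⬝ᵥ v from Finset.sum_nonneg fun i _ => mul_self_nonneg _).lt_of_ne'
      (by simpa using hv)
  rw [← pow_lt_pow_iff_left₀ dist_nonneg ht.le two_ne_zero, dist_veronese_sq, mul_assoc,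
    mul_comm (v ⬝ᵥ v), ← lt_div_iff₀ (mul_pos (hpos u hu) (hpos v hv))]
  constructor <;> intro h <;> linarith

theorem evalMonic_convex_combination {n : ℕ} (c d : Fin n → ℝ) {a b : ℝ} (hab : a + b = 1)
    (x : ℝ) : evalMonic n (a • c + b • d) x = a * evalMonic n c x + b * evalMonic n d x := by
  rw [evalMonic, evalMonic, evalMonic, mul_add, mul_add, Finset.mul_sum, Finset.mul_sum,
    add_add_add_comm, ← Finset.sum_add_distrib, ← add_mul, hab, one_mul]
  congr 1
  exact Finset.sum_congr rfl fun j _ => by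
    simp only [Pi.add_apply, Pi.smul_apply, smul_eq_mul]; ring

theorem continuous_dotProduct_evalMonic {n d m : ℕ} (c : Fin (m + 1) → Fin n → ℝ)
    (e : Fin (m + 1) → Fin d → ℝ) :
    Continuous fun x => (fun i => evalMonic n (c i) x) ⬝ᵥ (fun i => evalMonic d (e i) x) := by
  have hcont : ∀ (k : ℕ) (e : Fin k → ℝ), Continuous (evalMonic k e) := fun k e =>
    (continuous_evalMonic k).comp (by fun_prop : Continuous fun x : ℝ => (e, x))
  exact continuous_finsetSum _ fun i _ => (hcont _ _).mul (hcont _ _)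

theorem eventually_cobounded_dotProduct_evalMonic_pos {n d m : ℕ} (c : Fin (m + 1) → Fin n → ℝ)
    (e : Fin (m + 1) → Fin d → ℝ) :
    ∀ᶠ x in Bornology.cobounded ℝ,
      0 < ((fun i => evalMonic n (c i) x) ⬝ᵥ (fun i => evalMonic d (e i) x)) / x ^ (n + d) := by
  have hlim : ∀ (k : ℕ) (e : Fin k → ℝ),
      Tendsto (fun x => evalMonic k e x / x ^ k) (Bornology.cobounded ℝ) (𝓝 1) := fun k e =>
    (tendsto_evalMonic_div_pow e).comp (tendsto_const_nhds.prodMk tendsto_id)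
  have hlim' : Tendsto (fun x => ∑ i, (evalMonic n (c i) x / x ^ n) * (evalMonic d (e i) x / x ^ d))
      (Bornology.cobounded ℝ) (𝓝 (∑ _i : Fin (m + 1), 1 * 1)) :=
    tendsto_finsetSum _ fun i _ => (hlim _ _).mul (hlim _ _)
  have hpos : (0 : ℝ) < ∑ _i : Fin (m + 1), 1 * 1 := by
    simp only [mul_one, Finset.sum_const, Finset.card_univ, Fintype.card_fin, nsmul_eq_mul]
    positivity
  filter_upwards [hlim'.eventually (lt_mem_nhds hpos)] with x hx
  rw [dotProduct, Finset.sum_div]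
  simpa only [div_mul_div_comm, ← pow_add] using hx

theorem dotProduct_evalMonic_pos {n m : ℕ} (c d : Fin (m + 1) → Fin n → ℝ)
    (h : ∀ x, (fun i => evalMonic n (c i) x) ⬝ᵥ (fun i => evalMonic n (d i) x) ≠ 0) (x : ℝ) :
    0 < (fun i => evalMonic n (c i) x) ⬝ᵥ (fun i => evalMonic n (d i) x) := by
  set g : ℝ → ℝ := fun x => (fun i => evalMonic n (c i) x) ⬝ᵥ (fun i => evalMonic n (d i) x)
    with hg
  have hgc : Continuous g := continuous_dotProduct_evalMonic c d
  obtain ⟨y, hy, hy0⟩ := (((eventually_cobounded_dotProduct_evalMonic_pos c d).filter_mono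
    IsOrderBornology.atTop_le_cobounded).and (eventually_gt_atTop (0 : ℝ))).exists
  have hgy : 0 < g y := (div_pos_iff_of_pos_right (by positivity)).1 hy
  by_contra! hx
  obtain ⟨z, hz⟩ := mem_range_of_exists_le_of_exists_ge hgc ⟨x, hx⟩ ⟨y, hgy.le⟩
  exact h z hz

/-- Tuples whose loops are at distance less than `t` from the loop `f`. -/
def nearSet (n m : ℕ) (f : OmegaRP m) (t : ℝ) : Set (Fin (m + 1) → Fin n → ℝ) :=
  {c | ∃ h : c ∈ Dspace n m,
    dist (loopEmbedding m (toLoop n m ⟨c, h⟩)) (loopEmbedding m f) < t}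

theorem mem_nearSet_toLoop_iff {n m : ℕ} (d : Dspace n m) {t : ℝ} (ht : 0 < t) (ht1 : t ≤ 1)
    (c : Fin (m + 1) → Fin n → ℝ) :
    c ∈ nearSet n m (toLoop n m d) t ↔ ∀ x,
      √((1 - t ^ 2 / 2) * ((fun i => evalMonic n (d.1 i) x) ⬝ᵥ (fun i => evalMonic n (d.1 i) x))) *
        √((fun i => evalMonic n (c i) x) ⬝ᵥ (fun i => evalMonic n (c i) x)) <
      (fun i => evalMonic n (c i) x) ⬝ᵥ (fun i => evalMonic n (d.1 i) x) := by
  have hθ : 0 < 1 - t ^ 2 / 2 := by nlinarith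
  have hnn : ∀ v : Fin (m + 1) → ℝ, 0 ≤ v ⬝ᵥ v := fun v =>
    Finset.sum_nonneg fun i _ => mul_self_nonneg _
  constructor
  · rintro ⟨h, hdist⟩
    have hsq : ∀ x, (1 - t ^ 2 / 2) *
        ((fun i => evalMonic n (d.1 i) x) ⬝ᵥ (fun i => evalMonic n (d.1 i) x)) *
        ((fun i => evalMonic n (c i) x) ⬝ᵥ (fun i => evalMonic n (c i) x)) <
        ((fun i => evalMonic n (c i) x) ⬝ᵥ (fun i => evalMonic n (d.1 i) x)) ^ 2 := by
      intro x
      have h1 := (ContinuousMap.dist_lt_iff ht).1 hdist x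
      rw [loopEmbedding_apply, loopEmbedding_apply, toLoop_coe, toLoop_coe] at h1
      exact (dist_veronese_lt_iff _ _ _ _ ht).1 h1
    have hdot := dotProduct_evalMonic_pos c d.1 fun x hx => by
      have h1 := hsq x
      rw [hx] at h1
      have := mul_nonneg (mul_nonneg hθ.le (hnn fun i => evalMonic n (d.1 i) x))
        (hnn fun i => evalMonic n (c i) x)
      norm_num at h1
      linarith
    intro x
    rw [← Real.sqrt_mul (mul_nonneg hθ.le (hnn _))]
    exact (Real.sqrt_lt' (hdot x)).2 (hsq x)
  · intro h
    have hdot : ∀ x, 0 < (fun i => evalMonic n (c i) x) ⬝ᵥ (fun i => evalMonic n (d.1 i) x) :=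
      fun x => (mul_nonneg (Real.sqrt_nonneg _) (Real.sqrt_nonneg _)).trans_lt (h x)
    have hc : c ∈ Dspace n m := by
      intro x
      by_contra! h0
      have := hdot x
      simp [h0, dotProduct] at this
    refine ⟨hc, (ContinuousMap.dist_lt_iff ht).2 fun x => ?_⟩
    rw [loopEmbedding_apply, loopEmbedding_apply]
    induction x using OnePoint.rec with
    | infty =>
      rw [(toLoop n m _).2, (toLoop n m d).2, dist_self]
      exact ht
    | coe x =>
      rw [toLoop_coe, toLoop_coe, dist_veronese_lt_iff _ _ _ _ ht]
      have h1 := h x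
      rwa [← Real.sqrt_mul (mul_nonneg hθ.le (hnn _)), Real.sqrt_lt' (hdot x)] at h1

theorem convex_nearSet {n m : ℕ} (d : Dspace n m) {t : ℝ} (ht : 0 < t) (ht1 : t ≤ 1) :
    Convex ℝ (nearSet n m (toLoop n m d) t) := by
  intro c hc e he a b ha hb hab
  rw [mem_nearSet_toLoop_iff d ht ht1] at *
  intro x
  have hnorm : ∀ v : Fin (m + 1) → ℝ, √(v ⬝ᵥ v) = ‖WithLp.toLp 2 v‖ := fun v => by
    rw [EuclideanSpace.norm_eq]
    simp [dotProduct, sq]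
  have hval : (fun i => evalMonic n ((a • c + b • e) i) x) =
      a • (fun i => evalMonic n (c i) x) + b • (fun i => evalMonic n (e i) x) := by
    ext i
    exact evalMonic_convex_combination (c i) (e i) hab x
  rw [hval, hnorm, add_dotProduct, smul_dotProduct, smul_dotProduct, smul_eq_mul, smul_eq_mul]
  have h1 := hc x
  have h2 := he x
  set r := √((1 - t ^ 2 / 2) *
    ((fun i => evalMonic n (d.1 i) x) ⬝ᵥ (fun i => evalMonic n (d.1 i) x)))
  have hr : 0 ≤ r := Real.sqrt_nonneg _
  rw [hnorm] at h1 h2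
  have h3 : ‖WithLp.toLp 2 (a • (fun i => evalMonic n (c i) x) + b • fun i => evalMonic n (e i) x)‖
      ≤ a * ‖WithLp.toLp 2 fun i => evalMonic n (c i) x‖ +
        b * ‖WithLp.toLp 2 fun i => evalMonic n (e i) x‖ := by
    rw [WithLp.toLp_add, WithLp.toLp_smul, WithLp.toLp_smul]
    refine (norm_add_le _ _).trans (le_of_eq ?_)
    rw [norm_smul, norm_smul, Real.norm_of_nonneg ha, Real.norm_of_nonneg hb]
  have h4 := mul_le_mul_of_nonneg_left h3 hr
  refine h4.trans_lt ?_
  rcases ha.eq_or_lt with rfl | ha'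
  · obtain rfl : b = 1 := by linarith
    linarith
  · have := mul_lt_mul_of_pos_left h1 ha'
    have := mul_le_mul_of_nonneg_left h2.le hb
    nlinarith

theorem self_mem_nearSet {n m : ℕ} (d : Dspace n m) {t : ℝ} (ht : 0 < t) :
    d.1 ∈ nearSet n m (toLoop n m d) t :=
  ⟨d.2, by rwa [dist_self]⟩

instance metrizableSpace_OmegaRP (m : ℕ) : TopologicalSpace.MetrizableSpace (OmegaRP m) :=
  (isEmbedding_loopEmbedding m).metrizableSpace

/-- Pairs `(t, f)` consisting of a precision `t ∈ (0,1]` and a loop `f` in `R`. -/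
abbrev PrecisionPair (m : ℕ) (R : Set (OmegaRP m)) := {p : unitInterval × R // 0 < p.1}

theorem exists_continuous_mem_nearSet {n m : ℕ} (R : Set (OmegaRP m))
    (hR : R ⊆ Set.range (toLoop n m)) :
    ∃ s : C(PrecisionPair m R, Fin (m + 1) → Fin n → ℝ),
      ∀ p, s p ∈ nearSet n m p.1.2.1 p.1.1 := by
  have : TopologicalSpace.MetrizableSpace R := IsEmbedding.subtypeVal.metrizableSpace
  have : TopologicalSpace.MetrizableSpace (PrecisionPair m R) :=
    IsEmbedding.subtypeVal.metrizableSpace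
  let := TopologicalSpace.metrizableSpaceMetric (PrecisionPair m R)
  refine exists_continuous_forall_mem_convex_of_local_const (fun p => ?_) fun p => ?_
  · obtain ⟨d, hd⟩ := hR p.1.2.2
    rw [← hd]
    exact convex_nearSet d p.2 p.1.1.2.2
  · obtain ⟨d, hd⟩ := hR p.1.2.2
    refine ⟨d.1, ?_⟩
    have hcont : Continuous fun q : PrecisionPair m R =>
        dist (loopEmbedding m (toLoop n m d)) (loopEmbedding m q.1.2.1) :=
      continuous_const.dist ((isEmbedding_loopEmbedding m).continuous.comp
        (continuous_subtype_val.comp (continuous_snd.comp continuous_subtype_val)))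
    have hcont' : Continuous fun q : PrecisionPair m R => (q.1.1 : ℝ) :=
      continuous_subtype_val.comp (continuous_fst.comp continuous_subtype_val)
    have hlt : dist (loopEmbedding m (toLoop n m d)) (loopEmbedding m p.1.2.1) < (p.1.1 : ℝ) := by
      rw [hd, dist_self]
      exact p.2
    filter_upwards [hcont.continuousAt.eventually_lt hcont'.continuousAt hlt] with q hq
    exact ⟨d.2, hq⟩

/-- The map from `D(n,m)` to a set of loops containing the image of `P`. -/
def toLoopCod {n m : ℕ} {R : Set (OmegaRP m)} (hR : Set.range (toLoop n m) = R) :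
    C(Dspace n m, R) where
  toFun c := ⟨toLoop n m c, hR ▸ Set.mem_range_self c⟩
  continuous_toFun := (toLoop n m).continuous.subtype_mk _

theorem exists_homotopyEquiv {n m : ℕ} {R : Set (OmegaRP m)} (hR : Set.range (toLoop n m) = R) :
    ∃ h : ContinuousMap.HomotopyEquiv (Dspace n m) R,
      ∀ c, ((h.toFun c : R) : OmegaRP m) = toLoop n m c := by
  obtain ⟨s, hs⟩ := exists_continuous_mem_nearSet R hR.ge
  let S : C(PrecisionPair m R, Dspace n m) :=
    ⟨fun p => ⟨s p, (hs p).1⟩, s.continuous.subtype_mk _⟩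
  have hS : ∀ p, dist (loopEmbedding m (toLoop n m (S p))) (loopEmbedding m p.1.2.1) < p.1.1 :=
    fun p => (hs p).2
  let ι : C(R, PrecisionPair m R) :=
    ⟨fun f => ⟨(1, f), zero_lt_one⟩, by fun_prop⟩
  refine ⟨⟨toLoopCod hR, S.comp ι, ⟨?_⟩, ContinuousMap.Homotopic.symm ⟨?_⟩⟩, fun c => rfl⟩
  · have hmem : ∀ p : unitInterval × Dspace n m,
        (1 - (p.1 : ℝ)) • s (ι (toLoopCod hR p.2)) + (p.1 : ℝ) • p.2.1 ∈ Dspace n m := by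
      intro p
      have hconv := convex_nearSet p.2 zero_lt_one le_rfl
      exact (hconv (hs (ι (toLoopCod hR p.2))) (self_mem_nearSet p.2 zero_lt_one)
        (sub_nonneg.2 p.1.2.2) p.1.2.1 (sub_add_cancel _ _)).1
    have hcont : Continuous fun p : unitInterval × Dspace n m =>
        (1 - (p.1 : ℝ)) • s (ι (toLoopCod hR p.2)) + (p.1 : ℝ) • p.2.1 := by
      fun_prop
    refine ⟨⟨fun p => ⟨_, hmem p⟩, hcont.subtype_mk _⟩, fun c => ?_, fun c => ?_⟩
    · ext1
      simp [S]
    · ext1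
      simp
  · classical
    let K : unitInterval × R → R := fun p =>
      if h : 0 < p.1 then toLoopCod hR (S ⟨p, h⟩) else p.2
    have hdist : ∀ p, dist (loopEmbedding m (K p)) (loopEmbedding m p.2.1) ≤ p.1 := by
      intro p
      by_cases h : 0 < p.1
      · simp only [K, dif_pos h]
        exact (hS ⟨p, h⟩).le
      · simp only [K, dif_neg h, dist_self]
        exact p.1.2.1
    have hK : Continuous K := by
      rw [continuous_iff_continuousAt]
      intro p
      by_cases h : 0 < p.1
      · have hopen : IsOpen {p : unitInterval × R | 0 < p.1} :=
          isOpen_lt continuous_const continuous_fst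
        refine (hopen.isOpenEmbedding_subtypeVal.continuousAt_iff (x := ⟨p, h⟩)).1 ?_
        have : K ∘ Subtype.val = fun q : PrecisionPair m R => toLoopCod hR (S q) := by
          ext1 q
          exact dif_pos q.2
        refine Continuous.continuousAt (Continuous.congr ?_ fun q => (congrFun this q).symm)
        fun_prop
      · have hp : p.1 = 0 := le_antisymm (not_lt.1 h) p.1.2.1
        rw [((isEmbedding_loopEmbedding m).comp IsEmbedding.subtypeVal).isInducing.continuousAt_iff]
        have hKp : (loopEmbedding m ∘ Subtype.val ∘ K) p = loopEmbedding m p.2.1 := by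
          simp only [Function.comp_apply, K, dif_neg h]
        have hsnd : Continuous fun q : unitInterval × R => loopEmbedding m q.2.1 :=
          (isEmbedding_loopEmbedding m).continuous.comp
            (continuous_subtype_val.comp continuous_snd)
        have hfst : Tendsto (fun q : unitInterval × R => (q.1 : ℝ)) (𝓝 p) (𝓝 0) := by
          have : Continuous fun q : unitInterval × R => (q.1 : ℝ) := by fun_prop
          simpa [hp] using this.tendsto p
        have hzero : Tendsto (fun q : unitInterval × R =>
            dist (loopEmbedding m q.2.1) (loopEmbedding m (K q))) (𝓝 p) (𝓝 0) :=
          squeeze_zero (fun _ => dist_nonneg) (fun q => (dist_comm _ _).trans_le (hdist q)) hfst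
        show Tendsto (loopEmbedding m ∘ Subtype.val ∘ K) _
          (𝓝 ((loopEmbedding m ∘ Subtype.val ∘ K) p))
        rw [hKp]
        exact (tendsto_iff_of_dist hzero).1 (hsnd.tendsto p)
    refine ⟨⟨K, hK⟩, fun f => ?_, fun f => ?_⟩
    · exact dif_neg (lt_irrefl _)
    · exact dif_pos zero_lt_one

/-- The monic polynomial of degree `n` with the given lower-order coefficients. -/
def monicPoly (n : ℕ) (c : Fin n → ℝ) : Polynomial ℝ :=
  Polynomial.X ^ n + ∑ j : Fin n, Polynomial.C (c j) * Polynomial.X ^ (j : ℕ)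

theorem eval_monicPoly {n : ℕ} (c : Fin n → ℝ) (x : ℝ) :
    (monicPoly n c).eval x = evalMonic n c x := by
  simp [monicPoly, evalMonic, Polynomial.eval_finsetSum]

theorem monic_monicPoly {n : ℕ} (c : Fin n → ℝ) : (monicPoly n c).Monic :=
  Polynomial.monic_X_pow_add (Polynomial.degree_sum_fin_lt c)

theorem natDegree_monicPoly {n : ℕ} (c : Fin n → ℝ) : (monicPoly n c).natDegree = n := by
  refine Polynomial.natDegree_eq_of_degree_eq_some ?_
  rw [monicPoly, Polynomial.degree_add_eq_left_of_degree_lt, Polynomial.degree_X_pow]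
  rw [Polynomial.degree_X_pow]
  exact Polynomial.degree_sum_fin_lt c

theorem evalMonic_coeff {n : ℕ} {p : Polynomial ℝ} (hp : p.Monic) (hn : p.natDegree = n) (x : ℝ) :
    evalMonic n (fun j => p.coeff j) x = p.eval x := by
  subst hn
  conv_rhs => rw [hp.as_sum]
  simp [evalMonic, Polynomial.eval_finsetSum, Finset.sum_range]

theorem mem_range_toLoop_of_monic {n m : ℕ} (f : OmegaRP m) (p : Fin (m + 1) → Polynomial ℝ)
    (hp : ∀ i, (p i).Monic) (hn : ∀ i, (p i).natDegree = n)
    (hf : ∀ x : ℝ, ∃ hx : (fun i => (p i).eval x) ≠ 0,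
      f.1 (x : OnePoint ℝ) = Projectivization.mk ℝ (fun i => (p i).eval x) hx) :
    f ∈ Set.range (toLoop n m) := by
  have hev : ∀ x i, evalMonic n (fun j : Fin n => (p i).coeff j) x = (p i).eval x := fun x i =>
    evalMonic_coeff (hp i) (hn i) x
  have hmem : (fun i (j : Fin n) => (p i).coeff j) ∈ Dspace n m := by
    intro x
    obtain ⟨i, hi⟩ := Function.ne_iff.1 (hf x).1
    exact ⟨i, by rw [hev]; exact hi⟩
  refine ⟨⟨_, hmem⟩, Subtype.ext (ContinuousMap.ext fun x => ?_)⟩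
  induction x using OnePoint.rec with
  | infty => rw [(toLoop n m _).2, f.2]
  | coe x =>
    obtain ⟨hx, h⟩ := hf x
    rw [h, toLoop_coe]
    simp only [hev]

theorem RRat_subset_range_toLoop (n m : ℕ) : RRat n m ⊆ Set.range (toLoop n m) := by
  rintro f ⟨p, hp, hn, -, hf⟩
  exact mem_range_toLoop_of_monic f p hp hn hf

theorem toLoop_mem_RRat {n m : ℕ} (c : Dspace n m)
    (hc : ∀ z : ℂ, ∃ i, Polynomial.aeval z (monicPoly n (c.1 i)) ≠ 0) :
    toLoop n m c ∈ RRat n m := by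
  refine ⟨fun i => monicPoly n (c.1 i), fun i => monic_monicPoly _,
    fun i => natDegree_monicPoly _, hc, fun x => ?_⟩
  simp only [eval_monicPoly]
  exact ⟨evalMonic_ne_zero c x, toLoop_coe c x⟩

theorem mem_Dspace_of_aeval_ne_zero {n m : ℕ} {c : Fin (m + 1) → Fin n → ℝ}
    (hc : ∀ z : ℂ, ∃ i, Polynomial.aeval z (monicPoly n (c i)) ≠ 0) : c ∈ Dspace n m := by
  intro x
  obtain ⟨i, hi⟩ := hc (algebraMap ℝ ℂ x)
  refine ⟨i, fun h => hi ?_⟩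
  rw [Polynomial.aeval_algebraMap_apply, Polynomial.coe_aeval_eq_eval, eval_monicPoly, h, map_zero]

theorem toLoop_mem_ratSet {n m : ℕ} (hn : 1 ≤ n) (hm : 1 ≤ m) (c : Dspace n m) :
    toLoop n m c ∈ ratSet n m := by
  have hlast : (0 : Fin (m + 1)) ≠ Fin.last m := by
    rw [Ne, Fin.ext_iff]; simp; omega
  let c' : ℝ → Fin (m + 1) → Fin n → ℝ := fun ε =>
    c.1 + Pi.single (Fin.last m) (Pi.single ⟨0, hn⟩ ε)
  have hc'0 : ∀ ε, c' ε 0 = c.1 0 := fun ε => by simp [c', hlast]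
  have hc'l : ∀ ε, monicPoly n (c' ε (Fin.last m)) =
      monicPoly n (c.1 (Fin.last m)) + Polynomial.C ε := by
    intro ε
    simp only [c', monicPoly, Pi.add_apply, Pi.single_eq_same, map_add, add_mul,
      Finset.sum_add_distrib, ← add_assoc]
    congr 1
    rw [Finset.sum_eq_single ⟨0, hn⟩]
    · simp
    · intro j _ hj
      simp [hj]
    · simp
  have htend : Tendsto c' (𝓝[≠] 0) (𝓝 c.1) := by
    have hcont : Continuous c' := by
      refine continuous_const.add ((continuous_single (Fin.last m)).comp
        (continuous_single (A := fun _ : Fin n => ℝ) ⟨0, hn⟩))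
    have h0 : c' 0 = c.1 := by simp [c']
    rw [← h0]
    exact hcont.continuousAt.tendsto.mono_left nhdsWithin_le_nhds
  let B : Finset ℝ := ((monicPoly n (c.1 0)).aroots ℂ).toFinset.image
    fun z => -(Polynomial.aeval z (monicPoly n (c.1 (Fin.last m)))).re
  have hB : ∀ᶠ ε in 𝓝[≠] (0 : ℝ), ε ∉ B := by
    have h1 : ((↑(B.erase 0) : Set ℝ))ᶜ ∈ 𝓝 (0 : ℝ) :=
      (B.erase 0).finite_toSet.isClosed.isOpen_compl.mem_nhds (by simp)
    filter_upwards [mem_nhdsWithin_of_mem_nhds h1, self_mem_nhdsWithin] with ε hε hε0 hmem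
    exact hε (Finset.mem_erase.2 ⟨hε0, hmem⟩)
  have hmem : c ∈ closure {c : Dspace n m | toLoop n m c ∈ RRat n m} := by
    rw [closure_subtype]
    refine mem_closure_of_tendsto htend (hB.mono fun ε hε => ?_)
    have hne : ∀ z : ℂ, ∃ i, Polynomial.aeval z (monicPoly n (c' ε i)) ≠ 0 := by
      intro z
      by_contra! h
      have h0 := h 0
      have h1 := h (Fin.last m)
      rw [hc'0] at h0
      rw [hc'l, map_add, Polynomial.aeval_C] at h1
      refine hε (Finset.mem_image.2 ⟨z, ?_, ?_⟩)
      · rw [Multiset.mem_toFinset, Polynomial.mem_aroots]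
        exact ⟨(monic_monicPoly _).ne_zero, h0⟩
      · have := congrArg Complex.re h1
        simp at this
        linarith
    exact ⟨⟨c' ε, mem_Dspace_of_aeval_ne_zero hne⟩, toLoop_mem_RRat _ hne, rfl⟩
  exact map_mem_closure (toLoop n m).continuous hmem fun _ h => h

theorem exists_eq_mul_forall_exists_eval_ne_zero {ι : Type*} (A : ι → Polynomial ℝ) (i₀ : ι)
    (hA : A i₀ ≠ 0) :
    ∃ (g : Polynomial ℝ) (F : ι → Polynomial ℝ), g ≠ 0 ∧ (∀ i, A i = g * F i) ∧
      ∀ x, ∃ i, (F i).eval x ≠ 0 := by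
  induction h : (A i₀).natDegree using Nat.strong_induction_on generalizing A with
  | h k ih =>
    by_cases hroot : ∀ x, ∃ i, (A i).eval x ≠ 0
    · exact ⟨1, A, one_ne_zero, fun i => (one_mul _).symm, hroot⟩
    · push Not at hroot
      obtain ⟨r, hr⟩ := hroot
      choose B hB using fun i => Polynomial.dvd_iff_isRoot.2 (hr i)
      have hB0 : B i₀ ≠ 0 := by
        intro h0
        rw [hB, h0, mul_zero] at hA
        exact hA rfl
      have hdeg : (B i₀).natDegree < k := by
        rw [← h, hB, Polynomial.natDegree_mul (Polynomial.X_sub_C_ne_zero r) hB0,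
          Polynomial.natDegree_X_sub_C]
        omega
      obtain ⟨g, F, hg, hF, hne⟩ := ih _ hdeg B hB0 rfl
      exact ⟨(Polynomial.X - Polynomial.C r) * g, F,
        mul_ne_zero (Polynomial.X_sub_C_ne_zero r) hg,
        fun i => by rw [hB, hF, mul_assoc], hne⟩

theorem tendsto_eval_div_pow_atTop {p : Polynomial ℝ} {d : ℕ} (hp : p.natDegree ≤ d) :
    Tendsto (fun x => p.eval x / x ^ d) atTop (𝓝 (p.coeff d)) := by
  rcases hp.eq_or_lt with rfl | hlt
  · rcases eq_or_ne p 0 with rfl | h0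
    · simp
    · have := Polynomial.div_tendsto_atTop_leadingCoeff_div_of_degree_eq p
        (Polynomial.X ^ p.natDegree) (by
          rw [Polynomial.degree_X_pow, Polynomial.degree_eq_natDegree h0])
      simpa using this
  · have := Polynomial.div_tendsto_atTop_zero_of_degree_lt p (Polynomial.X ^ d) (by
      rw [Polynomial.degree_X_pow]
      exact Polynomial.degree_le_natDegree.trans_lt (by exact_mod_cast hlt))
    rw [Polynomial.coeff_eq_zero_of_natDegree_lt hlt]
    simpa using this

theorem continuous_veronese_loop {m : ℕ} (f : OmegaRP m) (i k : Fin (m + 1)) :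
    Continuous fun x : OnePoint ℝ => veronese m (f.1 x) (i, k) :=
  (PiLp.continuous_apply 2 _ _).comp ((continuous_veronese m).comp f.1.continuous)

/-- A loop everywhere parallel to a nonzero tuple of polynomials comes from a tuple of monic
polynomials without common real root, of no larger degree. -/
theorem exists_eq_toLoop_of_parallel {n m : ℕ} (f : OmegaRP m) (A : Fin (m + 1) → Polynomial ℝ)
    (i₀ : Fin (m + 1)) (hA : A i₀ ≠ 0) (hdeg : ∀ i, (A i).natDegree ≤ n)
    (hpar : ∀ (x : ℝ) i, ∑ k, veronese m (f.1 x) (i, k) * (A k).eval x = (A i).eval x) :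
    ∃ d ≤ n, f ∈ Set.range (toLoop d m) := by
  obtain ⟨g, F, hg, hAF, hF⟩ := exists_eq_mul_forall_exists_eval_ne_zero A i₀ hA
  have hFne : ∀ x, (fun i => (F i).eval x) ≠ 0 := fun x => by
    obtain ⟨i, hi⟩ := hF x
    exact fun h => hi (congrFun h i)
  have hparF : ∀ (x : ℝ) i, ∑ k, veronese m (f.1 x) (i, k) * (F k).eval x = (F i).eval x := by
    intro x i
    have hdense : Dense ({x | g.IsRoot x}ᶜ) :=
      (Polynomial.finite_setOfPred_isRoot hg).countable.dense_compl ℝ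
    refine congrFun (Continuous.ext_on (f := fun x : ℝ =>
      ∑ k, veronese m (f.1 x) (i, k) * (F k).eval x) hdense ?_ (F i).continuous ?_) x
    · exact continuous_finsetSum _ fun k _ =>
        ((continuous_veronese_loop f i k).comp OnePoint.continuous_coe).mul (F k).continuous
    · intro y hy
      refine mul_left_cancel₀ (a := g.eval y) hy ?_
      have := hpar y i
      simp only [hAF, Polynomial.eval_mul] at this
      rw [← this, Finset.mul_sum]
      exact Finset.sum_congr rfl fun k _ => by ring
  obtain ⟨i₁, hi₁⟩ := Finite.exists_max fun i => (F i).degree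
  have hi₁0 : F i₁ ≠ 0 := by
    intro h0
    obtain ⟨i, hi⟩ := hF 0
    have := hi₁ i
    rw [h0, Polynomial.degree_zero, le_bot_iff, Polynomial.degree_eq_bot] at this
    exact hi (by rw [this, Polynomial.eval_zero])
  set d := (F i₁).natDegree
  have hFd : ∀ i, (F i).natDegree ≤ d := fun i => Polynomial.natDegree_le_natDegree (hi₁ i)
  have hl : (fun i => (F i).coeff d) ≠ 0 := fun h =>
    hi₁0 (Polynomial.leadingCoeff_eq_zero.1 (congrFun h i₁))
  have hbase : basept m = Projectivization.mk ℝ (fun i => (F i).coeff d) hl := by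
    rw [eq_mk_iff_sum_veronese]
    intro i
    have hcoe : Tendsto ((↑) : ℝ → OnePoint ℝ) atTop (𝓝 ∞) := by
      refine Tendsto.mono_left ?_ IsOrderBornology.atTop_le_cobounded
      rw [Metric.cobounded_eq_cocompact, ← coclosedCompact_eq_cocompact]
      exact OnePoint.tendsto_nhds_infty'.1 tendsto_id |>.2
    have h1 : Tendsto (fun x : ℝ => ∑ k, veronese m (f.1 x) (i, k) * ((F k).eval x / x ^ d)) atTop
        (𝓝 (∑ k, veronese m (f.1 ∞) (i, k) * (F k).coeff d)) :=
      tendsto_finsetSum _ fun k _ =>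
        (((continuous_veronese_loop f i k).tendsto ∞).comp hcoe).mul
          (tendsto_eval_div_pow_atTop (hFd k))
    rw [f.2] at h1
    refine tendsto_nhds_unique h1 ((tendsto_eval_div_pow_atTop (hFd i)).congr fun x => ?_)
    rw [← hparF x i, Finset.sum_div]
    exact Finset.sum_congr rfl fun k _ => mul_div_assoc _ _ _
  obtain ⟨a, ha⟩ := (Projectivization.mk_eq_mk_iff' ℝ _ _ hl _).1 hbase.symm
  have hcoeff : ∀ i, (F i).coeff d = a := fun i => by
    rw [← congrFun ha i, Pi.smul_apply, smul_eq_mul, mul_one]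
  have ha0 : a ≠ 0 := by
    rw [← hcoeff i₁]
    exact fun h => hi₁0 (Polynomial.leadingCoeff_eq_zero.1 h)
  have hFnat : ∀ i, (F i).natDegree = d := fun i =>
    Polynomial.natDegree_eq_of_le_of_coeff_ne_zero (hFd i) (by rwa [hcoeff])
  refine ⟨d, ?_, mem_range_toLoop_of_monic f (fun i => Polynomial.C a⁻¹ * F i) (fun i => ?_)
    (fun i => ?_) fun x => ?_⟩
  · have := hdeg i₁
    rw [hAF, Polynomial.natDegree_mul hg hi₁0] at this
    omega
  · refine Polynomial.monic_C_mul_of_mul_leadingCoeff_eq_one ?_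
    rw [Polynomial.leadingCoeff, hFnat, hcoeff, inv_mul_cancel₀ ha0]
  · rw [Polynomial.natDegree_C_mul (inv_ne_zero ha0), hFnat]
  · have hval : (fun i => (Polynomial.C a⁻¹ * F i).eval x) = a⁻¹ • fun i => (F i).eval x := by
      ext i
      simp
    have hne : (fun i => (Polynomial.C a⁻¹ * F i).eval x) ≠ 0 := by
      rw [hval]
      exact smul_ne_zero (inv_ne_zero ha0) (hFne x)
    refine ⟨hne, ?_⟩
    rw [(eq_mk_iff_sum_veronese _ _ (hFne x)).2 (hparF x)]
    exact ((Projectivization.mk_eq_mk_iff' ℝ _ _ _ _).2 ⟨a⁻¹, hval.symm⟩).symm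

theorem even_add_of_dist_lt_one {n d m : ℕ} (c : Dspace n m) (e : Dspace d m)
    (h : dist (loopEmbedding m (toLoop n m c)) (loopEmbedding m (toLoop d m e)) < 1) :
    Even (n + d) := by
  by_contra hodd
  rw [Nat.not_even_iff_odd] at hodd
  set g : ℝ → ℝ := fun x => (fun i => evalMonic n (c.1 i) x) ⬝ᵥ (fun i => evalMonic d (e.1 i) x)
    with hg
  have hgc : Continuous g := continuous_dotProduct_evalMonic c.1 e.1
  have hev := eventually_cobounded_dotProduct_evalMonic_pos c.1 e.1
  obtain ⟨y, hy, hy0⟩ := ((hev.filter_mono IsOrderBornology.atTop_le_cobounded).and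
    (eventually_gt_atTop (0 : ℝ))).exists
  obtain ⟨w, hw, hw0⟩ := ((hev.filter_mono IsOrderBornology.atBot_le_cobounded).and
    (eventually_lt_atBot (0 : ℝ))).exists
  have hgy : 0 < g y := (div_pos_iff_of_pos_right (by positivity)).1 hy
  have hgw : g w < 0 := by
    rcases div_pos_iff.1 hw with h1 | h1
    · exact absurd h1.2 (hodd.pow_neg hw0).not_gt
    · exact h1.1
  obtain ⟨z, hz⟩ := mem_range_of_exists_le_of_exists_ge hgc ⟨w, hgw.le⟩ ⟨y, hgy.le⟩
  have h1 := (ContinuousMap.dist_lt_iff one_pos).1 h z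
  rw [loopEmbedding_apply, loopEmbedding_apply, toLoop_coe, toLoop_coe,
    dist_veronese_lt_iff _ _ _ _ one_pos] at h1
  simp only [hg] at hz
  rw [hz] at h1
  have hnn : ∀ v : Fin (m + 1) → ℝ, 0 ≤ v ⬝ᵥ v := fun v =>
    Finset.sum_nonneg fun i _ => mul_self_nonneg _
  have := mul_nonneg (hnn fun i => evalMonic d (e.1 i) z) (hnn fun i => evalMonic n (c.1 i) z)
  norm_num at h1
  linarith

theorem toLoop_mem_range_toLoop_add {d m : ℕ} (e : Dspace d m) (k : ℕ) :
    toLoop d m e ∈ Set.range (toLoop (d + 2 * k) m) := by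
  have hq : (Polynomial.X ^ 2 + Polynomial.C 1 : Polynomial ℝ).Monic :=
    Polynomial.monic_X_pow_add_C 1 two_ne_zero
  refine mem_range_toLoop_of_monic _
    (fun i => monicPoly d (e.1 i) * (Polynomial.X ^ 2 + Polynomial.C 1) ^ k)
    (fun i => (monic_monicPoly _).mul (hq.pow k)) (fun i => ?_) fun x => ?_
  · rw [(monic_monicPoly _).natDegree_mul (hq.pow k), natDegree_monicPoly, hq.natDegree_pow,
      Polynomial.natDegree_X_pow_add_C, mul_comm]
  · have hval : (fun i => (monicPoly d (e.1 i) * (Polynomial.X ^ 2 + Polynomial.C 1) ^ k).eval x)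
        = (x ^ 2 + 1) ^ k • fun i => evalMonic d (e.1 i) x := by
      ext i
      simp [eval_monicPoly, mul_comm]
    have hne := smul_ne_zero (pow_ne_zero k (by positivity : x ^ 2 + 1 ≠ 0)) (evalMonic_ne_zero e x)
    rw [← hval] at hne
    refine ⟨hne, ?_⟩
    rw [toLoop_coe]
    exact ((Projectivization.mk_eq_mk_iff' ℝ _ _ _ _).2 ⟨_, hval.symm⟩).symm

theorem exists_parallel_of_mem_closure {n m : ℕ} {f : OmegaRP m}
    (hf : f ∈ closure (Set.range (toLoop n m))) :
    ∃ (A : Fin (m + 1) → Polynomial ℝ) (i₀ : Fin (m + 1)), A i₀ ≠ 0 ∧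
      (∀ i, (A i).natDegree ≤ n) ∧
      ∀ (x : ℝ) i, ∑ k, veronese m (f.1 x) (i, k) * (A k).eval x = (A i).eval x := by
  obtain ⟨u, hu, hlim⟩ := mem_closure_iff_seq_limit.1 hf
  choose c hc using hu
  let a : ℕ → ℝ × (Fin (m + 1) → Fin n → ℝ) := fun k => (1, (c k).1)
  have ha : ∀ k, ‖a k‖ ≠ 0 := fun k h => by
    have := congrArg Prod.fst (norm_eq_zero.1 h)
    exact one_ne_zero this
  obtain ⟨b, hb, φ, hφ, hφlim⟩ :=
    (isCompact_sphere (0 : ℝ × (Fin (m + 1) → Fin n → ℝ)) 1).tendsto_subseq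
    (x := fun k => ‖a k‖⁻¹ • a k) fun k => by simp [norm_smul, ha k]
  let A : Fin (m + 1) → Polynomial ℝ := fun i =>
    Polynomial.C b.1 * Polynomial.X ^ n +
      ∑ j : Fin n, Polynomial.C (b.2 i j) * Polynomial.X ^ (j : ℕ)
  have hAeval : ∀ i x, (A i).eval x = b.1 * x ^ n + ∑ j : Fin n, b.2 i j * x ^ (j : ℕ) := by
    intro i x
    simp [A, Polynomial.eval_finsetSum]
  have hne : ∃ i, A i ≠ 0 := by
    by_contra! h
    have hsum : ∀ i (l : ℕ), (∑ j : Fin n, Polynomial.C (b.2 i j) *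
        (Polynomial.X : Polynomial ℝ) ^ (j : ℕ)).coeff l =
        ∑ j : Fin n, if l = j then b.2 i j else 0 := by
      intro i l
      simp [Polynomial.coeff_X_pow]
    have hb1 : b.1 = 0 := by
      have := congrArg (fun p => p.coeff n) (h 0)
      simp only [A, Polynomial.coeff_add, hsum, Polynomial.coeff_C_mul, Polynomial.coeff_X_pow,
        if_true, mul_one, Polynomial.coeff_zero] at this
      rwa [Finset.sum_eq_zero fun j _ => if_neg j.2.ne', add_zero] at this
    have hb2 : b.2 = 0 := by
      ext i l
      have := congrArg (fun p => p.coeff l) (h i)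
      simpa [A, hsum, hb1, Fin.val_inj] using this
    have : b = 0 := Prod.ext hb1 hb2
    simp [this] at hb
  obtain ⟨i₀, hi₀⟩ := hne
  refine ⟨A, i₀, hi₀, fun i => ?_, fun x i => ?_⟩
  · refine Polynomial.natDegree_add_le_of_degree_le (Polynomial.natDegree_C_mul_X_pow_le _ _) ?_
    exact Polynomial.natDegree_le_of_degree_le (Polynomial.degree_sum_fin_lt _).le
  · have heval : ∀ k, Tendsto (fun j => ‖a (φ j)‖⁻¹ * evalMonic n ((c (φ j)).1 k) x) atTop
        (𝓝 ((A k).eval x)) := by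
      intro k
      have hcont : Continuous fun b : ℝ × (Fin (m + 1) → Fin n → ℝ) =>
          b.1 * x ^ n + ∑ j : Fin n, b.2 k j * x ^ (j : ℕ) := by fun_prop
      rw [hAeval]
      refine ((hcont.tendsto b).comp hφlim).congr fun j => ?_
      simp only [Function.comp_apply, a, Prod.smul_fst, Prod.smul_snd, Pi.smul_apply, smul_eq_mul,
        mul_one, evalMonic, mul_add, Finset.mul_sum, mul_assoc]
    have hver : ∀ k, Tendsto (fun j => veronese m ((toLoop n m (c (φ j))).1 x) (i, k)) atTop
        (𝓝 (veronese m (f.1 x) (i, k))) := by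
      intro k
      have hcont : Continuous fun f : OmegaRP m => veronese m (f.1 x) (i, k) :=
        (PiLp.continuous_apply 2 _ _).comp ((continuous_veronese m).comp
          ((continuous_eval_const (x : OnePoint ℝ)).comp continuous_subtype_val))
      refine ((hcont.tendsto f).comp (hlim.comp hφ.tendsto_atTop)).congr fun j => ?_
      simp only [Function.comp_apply, hc]
    refine tendsto_nhds_unique (tendsto_finsetSum _ fun k _ => (hver k).mul (heval k))
      ((heval i).congr fun j => ?_)
    rw [← (eq_mk_iff_sum_veronese _ _ _).1 (toLoop_coe (c (φ j)) x) i, Finset.mul_sum]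
    exact Finset.sum_congr rfl fun k _ => by ring

theorem closure_range_toLoop_subset (n m : ℕ) :
    closure (Set.range (toLoop n m)) ⊆ Set.range (toLoop n m) := by
  intro f hf
  obtain ⟨A, i₀, hA, hdeg, hpar⟩ := exists_parallel_of_mem_closure hf
  obtain ⟨d, hd, e, rfl⟩ := exists_eq_toLoop_of_parallel f A i₀ hA hdeg hpar
  have hopen : IsOpen {f : OmegaRP m |
      dist (loopEmbedding m f) (loopEmbedding m (toLoop d m e)) < 1} :=
    isOpen_lt ((isEmbedding_loopEmbedding m).continuous.dist continuous_const) continuous_const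
  obtain ⟨-, hlt, c, rfl⟩ := mem_closure_iff.1 hf _ hopen (by simp)
  have heven := even_add_of_dist_lt_one c e hlt
  obtain ⟨k, rfl⟩ : ∃ k, n = d + 2 * k := ⟨(n - d) / 2, by rw [Nat.even_iff] at heven; omega⟩
  exact toLoop_mem_range_toLoop_add e k

theorem range_toLoop {n m : ℕ} (hn : 1 ≤ n) (hm : 1 ≤ m) :
    Set.range (toLoop n m) = ratSet n m :=
  (Set.range_subset_iff.2 (toLoop_mem_ratSet hn hm)).antisymm
    ((closure_mono (RRat_subset_range_toLoop n m)).trans (closure_range_toLoop_subset n m))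

/-- For `n ≥ 1`, `m ≥ 1`: the map `P : D(n,m) → Ω ℝP^m` given by
`(p_0,…,p_m) ↦ (x ↦ [p_0(x) : ⋯ : p_m(x)], ∞ ↦ *)` is continuous, its image is exactly
`rat(n,m)`, and it is a homotopy equivalence from `D(n,m)` to `rat(n,m)`. -/
theorem dspace_to_ratSet (n m : ℕ) (hn : 1 ≤ n) (hm : 1 ≤ m) :
    ∃ P : C(↥(Dspace n m), OmegaRP m),
      (∀ c : ↥(Dspace n m), ∀ x : ℝ,
        ∃ hx : (fun i => evalMonic n (c.1 i) x) ≠ 0,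
          (P c).1 (x : OnePoint ℝ) =
            Projectivization.mk ℝ (fun i => evalMonic n (c.1 i) x) hx) ∧
      Set.range P = ratSet n m ∧
      ∃ h : ContinuousMap.HomotopyEquiv ↥(Dspace n m) ↥(ratSet n m),
        ∀ c : ↥(Dspace n m), ((h.toFun c : ↥(ratSet n m)) : OmegaRP m) = P c := by
  exact ⟨toLoop n m, fun c x => ⟨evalMonic_ne_zero c x, toLoop_coe c x⟩, range_toLoop hn hm,
    exists_homotopyEquiv (range_toLoop hn hm)⟩

end
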